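/- Fix a joint pmf p_{S,X} on finite alphabets 𝒮 × 𝒳, a finite alphabet 𝒴, and λ ≥ 0. For a channel κ : 𝒳 → pmf(𝒴), let the joint law of (S,X,Y) be p_{S,X}(s,x)·κ(y|x) (so the Markov chain S ↔ X ↔ Y holds), and write L_CPF(κ,λ) = I(S;Y) - λ·I(X;Y|S) and L_PF(κ,α) = I(S;Y) - α·I(X;Y) for the corresponding mutual informations. Then a channel κ* minimizes κ ↦ L_CPF(κ,λ) over all channels if and only if κ* minimizes κ ↦ L_PF(κ, λ/(λ+1)) over all channels. -/

import Mathlib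

open Finset

/-- Shannon entropy of a pmf on a finite alphabet. -/
noncomputable def Hent {α : Type*} [Fintype α] (p : α → ℝ) : ℝ :=
  -∑ a, p a * Real.log (p a)

/-- Shannon mutual information `I(A;B) = H(A) + H(B) - H(A,B)` of a joint pmf. -/
noncomputable def Imi {α β : Type*} [Fintype α] [Fintype β] (p : α × β → ℝ) : ℝ :=
  Hent (fun a => ∑ b, p (a, b)) + Hent (fun b => ∑ a, p (a, b)) - Hent p

/-- Conditional mutual information `I(A;B|S) = H(S,A) + H(S,B) - H(S,A,B) - H(S)`,
conditioning on the first coordinate. -/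
noncomputable def Icmi {σ α β : Type*} [Fintype σ] [Fintype α] [Fintype β]
    (p : σ × α × β → ℝ) : ℝ :=
  Hent (fun sa : σ × α => ∑ b, p (sa.1, sa.2, b))
    + Hent (fun sb : σ × β => ∑ a, p (sb.1, a, sb.2))
    - Hent p - Hent (fun s => ∑ a, ∑ b, p (s, a, b))

/-- A channel `κ : 𝒳 → pmf(𝒴)`: each `κ x` is nonnegative and sums to one. -/
def IsChannel {X Y : Type*} [Fintype Y] (κ : X → Y → ℝ) : Prop :=
  (∀ x y, 0 ≤ κ x y) ∧ (∀ x, ∑ y, κ x y = 1)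

/-- The joint pmf `p(s,x,y) = p_{S,X}(s,x) · κ(y|x)` induced by a channel. -/
noncomputable def jointOf {S X Y : Type*} (pSX : S × X → ℝ) (κ : X → Y → ℝ) :
    S × X × Y → ℝ :=
  fun z => pSX (z.1, z.2.1) * κ z.2.1 z.2.2

/-- `I(S;Y)` under the joint pmf induced by `pSX` and the channel `κ`. -/
noncomputable def ISY {S X Y : Type*} [Fintype S] [Fintype X] [Fintype Y]
    (pSX : S × X → ℝ) (κ : X → Y → ℝ) : ℝ :=
  Imi (fun q : S × Y => ∑ x, jointOf pSX κ (q.1, x, q.2))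

/-- `I(X;Y)` under the joint pmf induced by `pSX` and the channel `κ`. -/
noncomputable def IXY {S X Y : Type*} [Fintype S] [Fintype X] [Fintype Y]
    (pSX : S × X → ℝ) (κ : X → Y → ℝ) : ℝ :=
  Imi (fun q : X × Y => ∑ s, jointOf pSX κ (s, q.1, q.2))

/-- `I(X;Y|S)` under the joint pmf induced by `pSX` and the channel `κ`. -/
noncomputable def IXYgS {S X Y : Type*} [Fintype S] [Fintype X] [Fintype Y]
    (pSX : S × X → ℝ) (κ : X → Y → ℝ) : ℝ :=
  Icmi (jointOf pSX κ)

/-- The conditional privacy funnel Lagrangian `L_CPF(κ,λ) = I(S;Y) - λ·I(X;Y|S)`. -/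
noncomputable def LCPF {S X Y : Type*} [Fintype S] [Fintype X] [Fintype Y]
    (pSX : S × X → ℝ) (κ : X → Y → ℝ) (l : ℝ) : ℝ :=
  ISY pSX κ - l * IXYgS pSX κ

/-- The privacy funnel Lagrangian `L_PF(κ,α) = I(S;Y) - α·I(X;Y)`. -/
noncomputable def LPF {S X Y : Type*} [Fintype S] [Fintype X] [Fintype Y]
    (pSX : S × X → ℝ) (κ : X → Y → ℝ) (a : ℝ) : ℝ :=
  ISY pSX κ - a * IXY pSX κ

theorem Hent_eq_sum_negMulLog {α : Type*} [Fintype α] (p : α → ℝ) :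
    Hent p = ∑ a, Real.negMulLog (p a) := by
  simp [Hent, Real.negMulLog]

/-- Reindexing invariance of entropy. -/
theorem Hent_comp_equiv {α β : Type*} [Fintype α] [Fintype β] (e : α ≃ β) (p : β → ℝ) :
    Hent (fun a => p (e a)) = Hent p := by
  simp only [Hent_eq_sum_negMulLog]
  exact e.sum_comp fun b => Real.negMulLog (p b)

/-- Chain rule for entropy: sending `a ∼ q` through a channel `w`. -/
theorem Hent_mul_channel {α β : Type*} [Fintype α] [Fintype β] (q : α → ℝ) {w : α → β → ℝ}
    (hw : ∀ a, ∑ b, w a b = 1) :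
    Hent (fun z : α × β => q z.1 * w z.1 z.2) = Hent q + ∑ a, q a * Hent (w a) := by
  simp only [Hent_eq_sum_negMulLog, Fintype.sum_prod_type, Real.negMulLog_mul,
    Finset.sum_add_distrib, ← Finset.sum_mul, ← Finset.mul_sum, hw, one_mul]

/-- The chain rule `I(S;Y) + I(X;Y|S) = I(X;Y)` for the Markov chain `S ↔ X ↔ Y`. -/
theorem ISY_add_IXYgS {S X Y : Type*} [Fintype S] [Fintype X] [Fintype Y]
    (pSX : S × X → ℝ) {κ : X → Y → ℝ} (hκ : ∀ x, ∑ y, κ x y = 1) :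
    ISY pSX κ + IXYgS pSX κ = IXY pSX κ := by
  have hSXY : Hent (jointOf pSX κ) = Hent pSX + ∑ z, pSX z * Hent (κ z.2) := by
    rw [← Hent_mul_channel pSX (w := fun z => κ z.2) fun z => hκ z.2,
      ← Hent_comp_equiv (Equiv.prodAssoc S X Y)]
    rfl
  have hXY : Hent (fun q : X × Y => ∑ s, jointOf pSX κ (s, q.1, q.2))
      = Hent (fun x => ∑ s, pSX (s, x)) + ∑ z, pSX z * Hent (κ z.2) := by
    have h := Hent_mul_channel (fun x => ∑ s, pSX (s, x)) hκ
    simp only [Finset.sum_mul] at h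
    rw [Fintype.sum_prod_type_right]
    exact h
  have hSX : (fun z : S × X => ∑ y, jointOf pSX κ (z.1, z.2, y)) = pSX := by
    funext z
    simp [jointOf, ← Finset.mul_sum, hκ]
  have hX : (fun x => ∑ y, ∑ s, jointOf pSX κ (s, x, y)) = fun x => ∑ s, pSX (s, x) := by
    funext x
    rw [Finset.sum_comm]
    simp [jointOf, ← Finset.mul_sum, hκ]
  have hS : (fun s => ∑ y, ∑ x, jointOf pSX κ (s, x, y))
      = fun s => ∑ x, ∑ y, jointOf pSX κ (s, x, y) := by
    funext s
    exact Finset.sum_comm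
  have hY : (fun y => ∑ s, ∑ x, jointOf pSX κ (s, x, y))
      = fun y => ∑ x, ∑ s, jointOf pSX κ (s, x, y) := by
    funext y
    exact Finset.sum_comm
  simp only [ISY, IXYgS, IXY, Imi, Icmi]
  rw [hSXY, hXY, hSX, hX, hS, hY]
  ring

/-- The two Lagrangians agree up to the factor `l + 1`. -/
theorem LCPF_eq_mul_LPF {S X Y : Type*} [Fintype S] [Fintype X] [Fintype Y]
    (pSX : S × X → ℝ) {κ : X → Y → ℝ} (hκ : ∀ x, ∑ y, κ x y = 1) {l : ℝ} (hl : l + 1 ≠ 0) :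
    LCPF pSX κ l = (l + 1) * LPF pSX κ (l / (l + 1)) := by
  rw [LCPF, LPF, ← ISY_add_IXYgS pSX hκ]
  field_simp
  ring

/-- For a fixed joint pmf `p_{S,X}` on finite alphabets and `λ ≥ 0`, a channel `κ*`
minimizes `κ ↦ L_CPF(κ,λ)` over all channels if and only if it minimizes
`κ ↦ L_PF(κ, λ/(λ+1))` over all channels. -/
theorem statement3 {S X Y : Type*} [Fintype S] [Fintype X] [Fintype Y]
    (pSX : S × X → ℝ) (hp0 : ∀ z, 0 ≤ pSX z) (hp1 : ∑ z, pSX z = 1)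
    (l : ℝ) (hl : 0 ≤ l)
    (κstar : X → Y → ℝ) (hκstar : IsChannel κstar) :
    (∀ κ : X → Y → ℝ, IsChannel κ → LCPF pSX κstar l ≤ LCPF pSX κ l)
      ↔ (∀ κ : X → Y → ℝ, IsChannel κ →
          LPF pSX κstar (l / (l + 1)) ≤ LPF pSX κ (l / (l + 1))) := by
  have hpos : 0 < l + 1 := by positivity
  refine forall₂_congr fun κ hκ => ?_
  rw [LCPF_eq_mul_LPF pSX hκstar.2 hpos.ne', LCPF_eq_mul_LPF pSX hκ.2 hpos.ne',
    mul_le_mul_iff_right₀ hpos]
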